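/- Suppose that f: ℝ² → {-1, +1} is constant on each unit cell x + [0,1)², x ∈ ℤ². Then for arbitrarily large R > 0 there is a circular arc I of radius R such that |∫_I f| ≥ C √R, where C > 0 is an absolute constant and the integral is with respect to arc-length on I. -/

import Mathlib

open MeasureTheory Real

abbrev Pt := EuclideanSpace ℝ (Fin 2)

noncomputable def pt (a b : ℝ) : Pt := (WithLp.equiv 2 (Fin 2 → ℝ)).symm ![a, b]

noncomputable def dir (θ : ℝ) : Pt := pt (Real.cos θ) (Real.sin θ)

/-- The integral of `f` over the circular arc of radius `R` centered at `x` spanning the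
angles `[θ₁, θ₂]`, with respect to arc-length. -/
noncomputable def arcInt (f : Pt → ℝ) (x : Pt) (R θ₁ θ₂ : ℝ) : ℝ :=
  ∫ θ in θ₁..θ₂, f (x + R • dir θ) * R

/-- The Bessel function `2π J₀`. -/
noncomputable def besselP (t : ℝ) : ℝ := ∫ θ in (0 : ℝ)..2 * π, cos (t * cos θ)

/-- The Bessel function `2π J₁`. -/
noncomputable def besselS (t : ℝ) : ℝ := ∫ θ in (0 : ℝ)..2 * π, cos θ * sin (t * cos θ)

lemma hasDerivAt_besselP (t : ℝ) : HasDerivAt besselP (-besselS t) t := by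
  have h := (intervalIntegral.hasDerivAt_integral_of_dominated_loc_of_deriv_le (𝕜 := ℝ)
    (μ := volume) (a := 0) (b := 2 * π) (F := fun t θ => cos (t * cos θ))
    (F' := fun t θ => -(cos θ * sin (t * cos θ))) (x₀ := t) (s := Set.univ) (bound := fun _ => 1)
    Filter.univ_mem (Filter.Eventually.of_forall fun x => by fun_prop)
    (Continuous.intervalIntegrable (by fun_prop) _ _) (by fun_prop)
    (Filter.Eventually.of_forall fun θ _ x _ => by
      rw [norm_neg, norm_mul, Real.norm_eq_abs, Real.norm_eq_abs]
      exact mul_le_one₀ (abs_cos_le_one _) (abs_nonneg _) (abs_sin_le_one _))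
    (by simp)
    (Filter.Eventually.of_forall fun θ _ x _ => by
      refine ((hasDerivAt_id x).mul_const (cos θ)).cos.congr_deriv ?_
      simp only [id]; ring)).2
  refine h.congr_deriv ?_
  simp [besselS, intervalIntegral.integral_neg]

lemma hasDerivAt_besselS_integral (t : ℝ) :
    HasDerivAt besselS (∫ θ in (0 : ℝ)..2 * π, cos θ ^ 2 * cos (t * cos θ)) t := by
  exact (intervalIntegral.hasDerivAt_integral_of_dominated_loc_of_deriv_le (𝕜 := ℝ)
    (μ := volume) (a := 0) (b := 2 * π) (F := fun t θ => cos θ * sin (t * cos θ))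
    (F' := fun t θ => cos θ ^ 2 * cos (t * cos θ)) (x₀ := t) (s := Set.univ) (bound := fun _ => 1)
    Filter.univ_mem (Filter.Eventually.of_forall fun x => by fun_prop)
    (Continuous.intervalIntegrable (by fun_prop) _ _) (by fun_prop)
    (Filter.Eventually.of_forall fun θ _ x _ => by
      rw [norm_mul, norm_pow, Real.norm_eq_abs, Real.norm_eq_abs]
      exact mul_le_one₀ (pow_le_one₀ (abs_nonneg _) (abs_cos_le_one _)) (abs_nonneg _)
        (abs_cos_le_one _))
    (by simp)
    (Filter.Eventually.of_forall fun θ _ x _ => by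
      refine ((((hasDerivAt_id x).mul_const (cos θ)).sin).const_mul (cos θ)).congr_deriv ?_
      simp only [id]; ring)).2

lemma besselS_eq_mul (t : ℝ) :
    besselS t = t * (besselP t - ∫ θ in (0 : ℝ)..2 * π, cos θ ^ 2 * cos (t * cos θ)) := by
  have h := intervalIntegral.integral_eq_sub_of_hasDerivAt (a := 0) (b := 2 * π)
    (f := fun θ => sin θ * sin (t * cos θ))
    (f' := fun θ => cos θ * sin (t * cos θ)
      - t * (cos (t * cos θ) - cos θ ^ 2 * cos (t * cos θ)))
    (fun θ _ => by
      refine ((hasDerivAt_sin θ).mul (((hasDerivAt_cos θ).const_mul t).sin)).congr_deriv ?_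
      have := sin_sq_add_cos_sq θ
      linear_combination (-t * cos (t * cos θ)) * this)
    (Continuous.intervalIntegrable (by fun_prop) _ _)
  rw [intervalIntegral.integral_sub (Continuous.intervalIntegrable (by fun_prop) _ _)
    (Continuous.intervalIntegrable (by fun_prop) _ _), intervalIntegral.integral_const_mul,
    intervalIntegral.integral_sub (Continuous.intervalIntegrable (by fun_prop) _ _)
    (Continuous.intervalIntegrable (by fun_prop) _ _)] at h
  simp only [sin_two_pi, sin_zero, zero_mul, sub_zero] at h
  simp only [besselS, besselP]
  linarith

lemma hasDerivAt_besselS {t : ℝ} (ht : 0 < t) :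
    HasDerivAt besselS (besselP t - besselS t / t) t := by
  refine (hasDerivAt_besselS_integral t).congr_deriv ?_
  rw [besselS_eq_mul t, mul_div_cancel_left₀ _ ht.ne', sub_sub_cancel]

lemma pi_le_besselP {t : ℝ} (h0 : 0 ≤ t) (h1 : t ≤ 1) : π ≤ besselP t := by
  have h : ∫ _ in (0 : ℝ)..2 * π, (1 / 2 : ℝ) ≤ besselP t := by
    refine intervalIntegral.integral_mono_on (by positivity) (by simp)
      (Continuous.intervalIntegrable (by fun_prop) _ _) fun θ _ => ?_
    have h2 := one_sub_sq_div_two_le_cos (x := t * cos θ)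
    have h3 : (t * cos θ) ^ 2 ≤ 1 := by
      rw [mul_pow]
      exact mul_le_one₀ (pow_le_one₀ h0 h1) (sq_nonneg _) (cos_sq_le_one θ)
    linarith
  simp at h
  linarith

/-- A modified energy of Bessel's equation for `√t J₀`: it becomes increasing on
`[1, ∞)` after multiplication by `1 - 1 / (4 t²)`. -/
noncomputable def besselEnergy (t : ℝ) : ℝ :=
  (t * (besselP t ^ 2 + besselS t ^ 2) - besselP t * besselS t + besselP t ^ 2 / (2 * t))

lemma mul_sq_le_besselEnergy {t : ℝ} (ht : 0 < t) : t * besselP t ^ 2 ≤ besselEnergy t := by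
  have : besselEnergy t - t * besselP t ^ 2
      = t * (besselS t - besselP t / (2 * t)) ^ 2 + besselP t ^ 2 / (4 * t) := by
    unfold besselEnergy; field_simp; ring
  have : 0 ≤ besselEnergy t - t * besselP t ^ 2 := by rw [this]; positivity
  linarith

lemma hasDerivAt_besselEnergy {t : ℝ} (ht : 0 < t) :
    HasDerivAt besselEnergy (-besselP t ^ 2 / (2 * t ^ 2)) t := by
  have hP := hasDerivAt_besselP t
  have hS := hasDerivAt_besselS ht
  have h := (((hasDerivAt_id t).mul ((hP.pow 2).add (hS.pow 2))).sub (hP.mul hS)).add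
    ((hP.pow 2).div ((hasDerivAt_id t).const_mul 2) (by simpa using ht.ne'))
  refine h.congr_deriv ?_
  simp
  field_simp
  ring

lemma monotoneOn_besselEnergy :
    MonotoneOn (fun t => besselEnergy t * (1 - 1 / (4 * t ^ 2))) (Set.Ici 1) := by
  have hd : ∀ t : ℝ, 1 ≤ t → HasDerivAt (fun t => besselEnergy t * (1 - 1 / (4 * t ^ 2)))
      (-besselP t ^ 2 / (2 * t ^ 2) * (1 - 1 / (4 * t ^ 2)) + besselEnergy t * (1 / (2 * t ^ 3)))
      t := by
    intro t ht
    have ht0 : 0 < t := by linarith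
    have h := (hasDerivAt_besselEnergy ht0).mul
      ((((hasDerivAt_pow 2 t).const_mul 4).inv (by positivity)).const_sub 1)
    simp only [one_div]
    refine h.congr_deriv ?_
    simp
    field_simp
    ring
  refine monotoneOn_of_deriv_nonneg (convex_Ici 1)
    (fun t ht => (hd t ht).continuousAt.continuousWithinAt)
    (fun t ht => (hd t (interior_subset ht)).differentiableAt.differentiableWithinAt)
    fun t ht => ?_
  have ht1 : 1 ≤ t := interior_subset ht
  have ht0 : 0 < t := by linarith
  rw [(hd t ht1).deriv]
  have h1 := mul_le_mul_of_nonneg_right (mul_sq_le_besselEnergy ht0)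
    (by positivity : 0 ≤ 1 / (2 * t ^ 3))
  have h2 : t * besselP t ^ 2 * (1 / (2 * t ^ 3))
      + -besselP t ^ 2 / (2 * t ^ 2) * (1 - 1 / (4 * t ^ 2)) = besselP t ^ 2 / (8 * t ^ 4) := by
    field_simp; ring
  have h3 : 0 ≤ besselP t ^ 2 / (8 * t ^ 4) := by positivity
  linarith

lemma besselP_sq_add_besselS_sq_ge {t : ℝ} (ht : 0 ≤ t) :
    6 / (1 + t) ≤ besselP t ^ 2 + besselS t ^ 2 := by
  have hpi := pi_gt_three
  rw [div_le_iff₀ (by positivity)]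
  rcases le_total t 1 with h | h
  · have h1 := pi_le_besselP ht h
    have h2 : 9 ≤ besselP t ^ 2 := by nlinarith
    nlinarith [sq_nonneg (besselS t)]
  · have h1 := pi_le_besselP zero_le_one le_rfl
    have h2 : 9 ≤ besselP 1 ^ 2 := by nlinarith
    have h3 := mul_sq_le_besselEnergy one_pos
    have h4 := monotoneOn_besselEnergy (Set.mem_Ici.2 le_rfl) (Set.mem_Ici.2 h) h
    have ht0 : 0 < t := by linarith
    have h5 : 0 ≤ besselEnergy t :=
      le_trans (by positivity) (mul_sq_le_besselEnergy ht0)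
    have h6 : besselEnergy t * (1 - 1 / (4 * t ^ 2)) ≤ besselEnergy t := by
      have : 0 ≤ 1 / (4 * t ^ 2) := by positivity
      nlinarith
    have h7 : besselP t ^ 2 / (2 * t) ≤ besselP t ^ 2 / 2 := by
      gcongr
      linarith
    have h8 : besselEnergy t ≤ (1 + t) * (besselP t ^ 2 + besselS t ^ 2) := by
      unfold besselEnergy
      nlinarith [sq_nonneg (besselP t + besselS t)]
    have h9 : (1 : ℝ) - 1 / (4 * 1 ^ 2) = 3 / 4 := by norm_num
    simp only [h9] at h4
    linarith

lemma AddChar.sum_norm_sq_sum_mul {G : Type*} [AddCommGroup G] [Fintype G] (h : G → ℂ) :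
    ∑ ψ : AddChar G ℂ, ‖∑ x, h x * ψ x‖ ^ 2 = Fintype.card G * ∑ x, ‖h x‖ ^ 2 := by
  classical
  have key : ∑ ψ : AddChar G ℂ, ((‖∑ x, h x * ψ x‖ ^ 2 : ℝ) : ℂ)
      = Fintype.card G * ∑ x, ((‖h x‖ ^ 2 : ℝ) : ℂ) := by
    have h1 : ∀ ψ : AddChar G ℂ, ((‖∑ x, h x * ψ x‖ ^ 2 : ℝ) : ℂ)
        = ∑ x, ∑ y, h x * starRingEnd ℂ (h y) * ψ (x - y) := by
      intro ψ
      push_cast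
      rw [← Complex.mul_conj', map_sum, Finset.sum_mul_sum]
      refine Finset.sum_congr rfl fun x _ => Finset.sum_congr rfl fun y _ => ?_
      rw [map_mul, sub_eq_add_neg, AddChar.map_add_eq_mul, AddChar.map_neg_eq_conj]
      ring
    simp_rw [h1]
    rw [Finset.sum_comm, Finset.mul_sum]
    refine Finset.sum_congr rfl fun x _ => ?_
    rw [Finset.sum_comm]
    simp_rw [← Finset.mul_sum, AddChar.sum_apply_eq_ite, sub_eq_zero]
    simp only [mul_ite, mul_zero, Finset.sum_ite_eq, Finset.mem_univ, if_true]
    push_cast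
    rw [← Complex.mul_conj']
    ring
  exact_mod_cast key

lemma AddChar.exists_angles {M : ℕ} [NeZero M] (ψ : AddChar (ZMod M × ZMod M) ℂ) :
    ∃ η₁ η₂ : ℝ, |η₁| ≤ π ∧ |η₂| ≤ π ∧ ∀ a b : ℤ,
      ψ ((a : ZMod M), (b : ZMod M)) = Complex.exp ((η₁ * a + η₂ * b : ℝ) * Complex.I) := by
  have hexp : ∀ z : ZMod M × ZMod M, ψ z = Complex.exp (Complex.arg (ψ z) * Complex.I) := by
    intro z
    have := Complex.norm_mul_exp_arg_mul_I (ψ z)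
    rwa [AddChar.norm_apply, Complex.ofReal_one, one_mul, eq_comm] at this
  refine ⟨Complex.arg (ψ (1, 0)), Complex.arg (ψ (0, 1)), Complex.abs_arg_le_pi _,
    Complex.abs_arg_le_pi _, fun a b => ?_⟩
  have h : ((a : ZMod M), (b : ZMod M)) = a • ((1 : ZMod M), (0 : ZMod M))
      + b • ((0 : ZMod M), (1 : ZMod M)) := by
    ext <;> simp
  rw [h, AddChar.map_add_eq_mul, AddChar.map_zsmul_eq_zpow, AddChar.map_zsmul_eq_zpow,
    hexp (1, 0), hexp (0, 1), ← Complex.exp_int_mul, ← Complex.exp_int_mul, ← Complex.exp_add,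
    ← hexp, ← hexp]
  congr 1
  push_cast
  ring

/-- The factor lost by replacing a plane wave by its values on unit cells. -/
noncomputable def cellFactor (η : ℝ) : ℂ :=
  ∫ s in (0 : ℝ)..1, Complex.exp ((η * (s - 1 / 2) : ℝ) * Complex.I)

lemma half_le_norm_cellFactor {η : ℝ} (hη : |η| ≤ π) : 1 / 2 ≤ ‖cellFactor η‖ := by
  have hre : (cellFactor η).re = ∫ s in (0 : ℝ)..1, cos (η * (s - 1 / 2)) := by
    unfold cellFactor
    have h2 := Complex.reCLM.intervalIntegral_comp_comm (μ := volume) (a := 0) (b := 1)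
      (f := fun s : ℝ => Complex.exp ((η * (s - 1 / 2) : ℝ) * Complex.I))
      (Continuous.intervalIntegrable (by fun_prop) _ _)
    simp only [Complex.reCLM_apply, Complex.exp_ofReal_mul_I_re] at h2
    exact h2.symm
  refine le_trans ?_ (Complex.re_le_norm _)
  rw [hre]
  have hpi : π ^ 2 ≤ 12 := by nlinarith [pi_lt_d2, pi_gt_three]
  have hη2 : η ^ 2 ≤ 12 := by
    rw [← sq_abs]; nlinarith [abs_nonneg η, pi_pos]
  have h1 : ∫ s in (0 : ℝ)..1, (1 - η ^ 2 * (s - 1 / 2) ^ 2 / 2) = 1 - η ^ 2 / 24 := by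
    have := intervalIntegral.integral_eq_sub_of_hasDerivAt (a := 0) (b := 1)
      (f := fun s : ℝ => s - η ^ 2 * (s - 1 / 2) ^ 3 / 6)
      (f' := fun s => 1 - η ^ 2 * (s - 1 / 2) ^ 2 / 2)
      (fun s _ => by
        refine ((hasDerivAt_id s).sub (((((hasDerivAt_id s).sub_const (1 / 2)).pow 3).const_mul
          (η ^ 2)).div_const 6)).congr_deriv ?_
        simp
        ring)
      (Continuous.intervalIntegrable (by fun_prop) _ _)
    rw [this]
    ring
  calc (1 / 2 : ℝ) ≤ 1 - η ^ 2 / 24 := by linarith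
    _ = _ := h1.symm
    _ ≤ _ := intervalIntegral.integral_mono_on zero_le_one
        (Continuous.intervalIntegrable (by fun_prop) _ _)
        (Continuous.intervalIntegrable (by fun_prop) _ _) fun s _ => by
          have := one_sub_sq_div_two_le_cos (x := η * (s - 1 / 2))
          rwa [mul_pow] at this

lemma integral_exp_sub_floor (η v : ℝ) :
    ∫ u in (0 : ℝ)..1, Complex.exp ((η * (u - 1 / 2 - ⌊u + v⌋) : ℝ) * Complex.I)
      = Complex.exp ((-(η * v) : ℝ) * Complex.I) * cellFactor η := by
  have hper : Function.Periodic
      (fun x : ℝ => Complex.exp ((η * (Int.fract x - 1 / 2) : ℝ) * Complex.I)) 1 := by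
    intro x
    simp only [Int.fract_add_one]
  have h0 : cellFactor η
      = ∫ x in (0 : ℝ)..1, Complex.exp ((η * (Int.fract x - 1 / 2) : ℝ) * Complex.I) := by
    refine intervalIntegral.integral_congr_Ioo_of_le zero_le_one fun x hx => ?_
    simp only [Int.fract_eq_self.2 ⟨hx.1.le, hx.2⟩]
  have h1 := hper.intervalIntegral_add_eq 0 v
  rw [zero_add] at h1
  rw [h0, h1, ← intervalIntegral.integral_const_mul]
  have h2 := intervalIntegral.integral_comp_add_right (a := 0) (b := 1)
    (fun x : ℝ => Complex.exp ((-(η * v) : ℝ) * Complex.I)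
      * Complex.exp ((η * (Int.fract x - 1 / 2) : ℝ) * Complex.I)) v
  rw [zero_add, add_comm 1 v] at h2
  rw [← h2]
  refine intervalIntegral.integral_congr fun u _ => ?_
  rw [← Complex.exp_add, Int.fract]
  congr 1
  push_cast
  ring

lemma abs_integral_mul_le_of_abs_integral_le {h w w' : ℝ → ℝ} {D : ℝ}
    (hfin : IntervalIntegrable h volume 0 (2 * π))
    (hD : ∀ s ∈ Set.Icc 0 (2 * π), |∫ θ in (0 : ℝ)..s, h θ| ≤ D)
    (hw : ∀ x, HasDerivAt w (w' x) x) (hc : Continuous w') (hw1 : ∀ x, |w x| ≤ 1)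
    (hw1' : ∀ x, |w' x| ≤ 1) :
    |∫ θ in (0 : ℝ)..2 * π, w θ * h θ| ≤ (1 + 2 * π) * D := by
  have h0 : (0 : ℝ) ≤ 2 * π := by positivity
  have hF := hfin.absolutelyContinuousOnInterval_intervalIntegral (c := 0) (by simp)
  have hwd : deriv w = w' := funext fun x => (hw x).deriv
  have hw2 : AbsolutelyContinuousOnInterval w 0 (2 * π) :=
    (contDiff_one_iff_deriv.2 ⟨fun x => (hw x).differentiableAt, by
      rwa [hwd]⟩).contDiffOn.absolutelyContinuousOnInterval
  have hibp := hw2.integral_mul_deriv_eq_deriv_mul hF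
  have hcongr : ∫ θ in (0 : ℝ)..2 * π, w θ * h θ
      = ∫ θ in (0 : ℝ)..2 * π, w θ * deriv (fun x => ∫ v in (0 : ℝ)..x, h v) θ := by
    refine intervalIntegral.integral_congr_ae ?_
    filter_upwards [hfin.ae_hasDerivAt_integral] with x hx hx'
    rw [(hx (Set.uIoc_subset_uIcc hx') 0 (by simp)).deriv]
  rw [hcongr, hibp, hwd, intervalIntegral.integral_same, mul_zero, sub_zero]
  have h1 : |∫ x in (0 : ℝ)..2 * π, w' x * ∫ v in (0 : ℝ)..x, h v| ≤ D * |2 * π - 0| := by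
    rw [← Real.norm_eq_abs]
    refine intervalIntegral.norm_integral_le_of_norm_le_const fun x hx => ?_
    rw [Set.uIoc_of_le h0] at hx
    rw [norm_mul, Real.norm_eq_abs, Real.norm_eq_abs]
    have := hD x (Set.Ioc_subset_Icc_self hx)
    calc _ ≤ 1 * |∫ v in (0 : ℝ)..x, h v| := by gcongr; exact hw1' x
      _ ≤ D := by rwa [one_mul]
  have h2 : |w (2 * π) * ∫ v in (0 : ℝ)..2 * π, h v| ≤ D := by
    rw [abs_mul]
    calc _ ≤ 1 * |∫ v in (0 : ℝ)..2 * π, h v| := by gcongr; exact hw1 _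
      _ ≤ D := by rw [one_mul]; exact hD _ ⟨h0, le_rfl⟩
  rw [sub_zero, abs_of_nonneg h0] at h1
  refine (abs_sub _ _).trans ?_
  linarith

lemma norm_integral_exp_mul_le {h : ℝ → ℝ} {D : ℝ}
    (hfin : IntervalIntegrable h volume 0 (2 * π))
    (hD : ∀ s ∈ Set.Icc 0 (2 * π), |∫ θ in (0 : ℝ)..s, h θ| ≤ D) :
    ‖∫ θ in (0 : ℝ)..2 * π, Complex.exp (θ * Complex.I) * h θ‖ ≤ 16 * D := by
  have hi : IntervalIntegrable (fun θ : ℝ => Complex.exp (θ * Complex.I) * h θ) volume 0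
      (2 * π) := IntervalIntegrable.continuousOn_mul ⟨hfin.1.ofReal, hfin.2.ofReal⟩
      (Continuous.continuousOn (by fun_prop))
  have hre := Complex.reCLM.intervalIntegral_comp_comm hi
  have him := Complex.imCLM.intervalIntegral_comp_comm hi
  simp only [Complex.reCLM_apply, Complex.imCLM_apply, Complex.re_mul_ofReal,
    Complex.im_mul_ofReal, Complex.exp_ofReal_mul_I_re, Complex.exp_ofReal_mul_I_im] at hre him
  have h1 := abs_integral_mul_le_of_abs_integral_le hfin hD hasDerivAt_cos
    continuous_sin.neg abs_cos_le_one (fun x => by rw [abs_neg]; exact abs_sin_le_one x)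
  have h2 := abs_integral_mul_le_of_abs_integral_le hfin hD hasDerivAt_sin
    continuous_cos abs_sin_le_one abs_cos_le_one
  rw [hre] at h1
  rw [him] at h2
  have hD0 : 0 ≤ D := (abs_nonneg _).trans (hD 0 ⟨le_rfl, by positivity⟩)
  refine (Complex.norm_le_abs_re_add_abs_im _).trans ?_
  nlinarith [pi_lt_d2]

lemma integral_sin_mul_cos_mul_cos (t : ℝ) :
    ∫ θ in (0 : ℝ)..2 * π, sin θ * cos (t * cos θ) = 0 := by
  have h := intervalIntegral.integral_comp_sub_left (a := 0) (b := 2 * π)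
    (fun θ => sin θ * cos (t * cos θ)) (2 * π)
  simp only [sin_two_pi_sub, cos_two_pi_sub, sub_self, sub_zero, neg_mul,
    intervalIntegral.integral_neg] at h
  linarith

lemma abs_besselP_le_norm (t : ℝ) :
    |besselP t| ≤ ‖∫ θ in (0 : ℝ)..2 * π, Complex.exp ((-(t * cos θ) : ℝ) * Complex.I)‖ := by
  have hre := Complex.reCLM.intervalIntegral_comp_comm (μ := volume) (a := 0) (b := 2 * π)
    (f := fun θ : ℝ => Complex.exp ((-(t * cos θ) : ℝ) * Complex.I))
    (Continuous.intervalIntegrable (by fun_prop) _ _)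
  simp only [Complex.reCLM_apply, Complex.exp_ofReal_mul_I_re, cos_neg] at hre
  rw [besselP, hre]
  exact Complex.abs_re_le_norm _

lemma abs_besselS_le_norm (t : ℝ) :
    |besselS t| ≤ ‖∫ θ in (0 : ℝ)..2 * π,
      Complex.exp (θ * Complex.I) * Complex.exp ((-(t * cos θ) : ℝ) * Complex.I)‖ := by
  have him := Complex.imCLM.intervalIntegral_comp_comm (μ := volume) (a := 0) (b := 2 * π)
    (f := fun θ : ℝ => Complex.exp (θ * Complex.I)
      * Complex.exp ((-(t * cos θ) : ℝ) * Complex.I))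
    (Continuous.intervalIntegrable (by fun_prop) _ _)
  simp only [Complex.imCLM_apply, Complex.mul_im, Complex.exp_ofReal_mul_I_im,
    Complex.exp_ofReal_mul_I_re, cos_neg, sin_neg] at him
  rw [intervalIntegral.integral_add (Continuous.intervalIntegrable (by fun_prop) _ _)
    (Continuous.intervalIntegrable (by fun_prop) _ _), integral_sin_mul_cos_mul_cos, add_zero]
    at him
  simp only [mul_neg, intervalIntegral.integral_neg] at him
  rw [← abs_neg, besselS, him]
  exact Complex.abs_im_le_norm _

/-- Rotating a plane wave to a horizontal one. -/
lemma exists_polar (η₁ η₂ : ℝ) : ∃ ρ α : ℝ, 0 ≤ ρ ∧ ρ ^ 2 = η₁ ^ 2 + η₂ ^ 2 ∧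
    ∀ θ, η₁ * cos θ + η₂ * sin θ = ρ * cos (θ - α) := by
  refine ⟨‖(⟨η₁, η₂⟩ : ℂ)‖, Complex.arg ⟨η₁, η₂⟩, norm_nonneg _, ?_, fun θ => ?_⟩
  · rw [← Complex.normSq_eq_norm_sq, Complex.normSq_mk]; ring
  · rw [cos_sub]
    have h1 := Complex.norm_mul_cos_arg ⟨η₁, η₂⟩
    have h2 := Complex.norm_mul_sin_arg ⟨η₁, η₂⟩
    simp only at h1 h2
    linear_combination (-cos θ) * h1 - sin θ * h2

lemma integral_comp_sub_eq_of_periodic {g : ℝ → ℂ} (hg : Function.Periodic g (2 * π)) (α : ℝ) :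
    ∫ θ in (0 : ℝ)..2 * π, g (θ - α) = ∫ θ in (0 : ℝ)..2 * π, g θ := by
  rw [intervalIntegral.integral_comp_sub_right, zero_sub]
  have := hg.intervalIntegral_add_eq (-α) 0
  rw [zero_add] at this
  rw [← this]
  congr 1
  ring

lemma one_div_le_norm_sq_add_norm_sq {R η₁ η₂ : ℝ} (hR : 1 ≤ R) (h₁ : |η₁| ≤ π)
    (h₂ : |η₂| ≤ π) :
    1 / R ≤ ‖∫ θ in (0 : ℝ)..2 * π,
        Complex.exp ((-(η₁ * (R * cos θ) + η₂ * (R * sin θ)) : ℝ) * Complex.I)‖ ^ 2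
      + ‖∫ θ in (0 : ℝ)..2 * π, Complex.exp (θ * Complex.I)
        * Complex.exp ((-(η₁ * (R * cos θ) + η₂ * (R * sin θ)) : ℝ) * Complex.I)‖ ^ 2 := by
  obtain ⟨ρ, α, hρ, hρ2, hpol⟩ := exists_polar η₁ η₂
  have hpol' : ∀ θ, η₁ * (R * cos θ) + η₂ * (R * sin θ) = R * ρ * cos (θ - α) := fun θ => by
    linear_combination R * hpol θ
  simp_rw [hpol']
  have e1 := integral_comp_sub_eq_of_periodic
    (g := fun θ => Complex.exp ((-(R * ρ * cos θ) : ℝ) * Complex.I))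
    (fun θ => by simp only [cos_add_two_pi]) α
  have e2 := integral_comp_sub_eq_of_periodic
    (g := fun θ => Complex.exp (θ * Complex.I)
      * Complex.exp ((-(R * ρ * cos θ) : ℝ) * Complex.I))
    (fun θ => by
      simp only [cos_add_two_pi]
      rw [Complex.ofReal_add, add_mul, Complex.exp_add]
      push_cast
      rw [Complex.exp_two_pi_mul_I, mul_one]) α
  have e3 : ∫ θ in (0 : ℝ)..2 * π, Complex.exp (θ * Complex.I)
        * Complex.exp ((-(R * ρ * cos (θ - α)) : ℝ) * Complex.I)
      = Complex.exp (α * Complex.I) * ∫ θ in (0 : ℝ)..2 * π,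
        Complex.exp ((θ - α : ℝ) * Complex.I)
        * Complex.exp ((-(R * ρ * cos (θ - α)) : ℝ) * Complex.I) := by
    rw [← intervalIntegral.integral_const_mul]
    refine intervalIntegral.integral_congr fun θ _ => ?_
    simp only [← Complex.exp_add]
    congr 1
    push_cast
    ring
  rw [e3, e1, e2, norm_mul, Complex.norm_exp_ofReal_mul_I, one_mul]
  have hP := abs_besselP_le_norm (R * ρ)
  have hS := abs_besselS_le_norm (R * ρ)
  have hb := besselP_sq_add_besselS_sq_ge (t := R * ρ) (by positivity)
  have hP2 := pow_le_pow_left₀ (abs_nonneg _) hP 2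
  have hS2 := pow_le_pow_left₀ (abs_nonneg _) hS 2
  rw [sq_abs] at hP2 hS2
  refine le_trans ?_ (hb.trans (add_le_add hP2 hS2))
  have hρ5 : ρ ≤ 5 := by
    have h1 : η₁ ^ 2 ≤ π ^ 2 := sq_le_sq' (abs_le.1 h₁).1 (abs_le.1 h₁).2
    have h2 : η₂ ^ 2 ≤ π ^ 2 := sq_le_sq' (abs_le.1 h₂).1 (abs_le.1 h₂).2
    nlinarith [pi_lt_d2, pi_pos]
  rw [div_le_div_iff₀ (by positivity) (by positivity)]
  nlinarith

/-- Lebesgue measure on the unit square. -/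
noncomputable def unitSquare : Measure (ℝ × ℝ) :=
  (volume.restrict (Set.Ioc (0 : ℝ) 1)).prod (volume.restrict (Set.Ioc (0 : ℝ) 1))

instance : IsProbabilityMeasure (volume.restrict (Set.Ioc (0 : ℝ) 1)) := ⟨by simp⟩

instance : IsProbabilityMeasure unitSquare := by unfold unitSquare; infer_instance

/-- The integral over the circle with center `u` and radius `R`, with weight `φ`, of the plane
wave of frequency `η` that is made constant on unit cells. -/
noncomputable def cellWaveInt (φ : ℝ → ℂ) (η₁ η₂ R : ℝ) (u : ℝ × ℝ) : ℂ :=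
  ∫ θ in (0 : ℝ)..2 * π, φ θ *
    Complex.exp ((-(η₁ * ⌊u.1 + R * cos θ⌋ + η₂ * ⌊u.2 + R * sin θ⌋) : ℝ) * Complex.I)

lemma measurable_cellWave {φ : ℝ → ℂ} (hφ : Continuous φ) (η₁ η₂ R : ℝ) :
    Measurable fun p : (ℝ × ℝ) × ℝ => φ p.2 * Complex.exp
      ((-(η₁ * ⌊p.1.1 + R * cos p.2⌋ + η₂ * ⌊p.1.2 + R * sin p.2⌋) : ℝ) * Complex.I) := by
  have h1 : Measurable fun p : (ℝ × ℝ) × ℝ => ((⌊p.1.1 + R * cos p.2⌋ : ℤ) : ℝ) :=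
    measurable_from_top.comp (Measurable.floor (by fun_prop))
  have h2 : Measurable fun p : (ℝ × ℝ) × ℝ => ((⌊p.1.2 + R * sin p.2⌋ : ℤ) : ℝ) :=
    measurable_from_top.comp (Measurable.floor (by fun_prop))
  have h3 := hφ.measurable
  fun_prop

lemma measurable_cellWaveInt {φ : ℝ → ℂ} (hφ : Continuous φ) (η₁ η₂ R : ℝ) :
    StronglyMeasurable (cellWaveInt φ η₁ η₂ R) := by
  unfold cellWaveInt
  simp_rw [intervalIntegral.integral_of_le two_pi_pos.le]
  exact (measurable_cellWave hφ η₁ η₂ R).stronglyMeasurable.integral_prod_right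

lemma norm_cellWaveInt_le {φ : ℝ → ℂ} (hφ : ∀ θ, ‖φ θ‖ ≤ 1) (η₁ η₂ R : ℝ) (u : ℝ × ℝ) :
    ‖cellWaveInt φ η₁ η₂ R u‖ ≤ 2 * π := by
  have := intervalIntegral.norm_integral_le_of_norm_le_const (a := 0) (b := 2 * π) (C := 1)
    (f := fun θ : ℝ => φ θ * Complex.exp
      ((-(η₁ * ⌊u.1 + R * cos θ⌋ + η₂ * ⌊u.2 + R * sin θ⌋) : ℝ) * Complex.I))
    (fun θ _ => by rw [norm_mul, Complex.norm_exp_ofReal_mul_I, mul_one]; exact hφ θ)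
  rwa [sub_zero, abs_of_pos two_pi_pos, one_mul] at this

lemma integrable_norm_sq_cellWaveInt {φ : ℝ → ℂ} (hc : Continuous φ) (hφ : ∀ θ, ‖φ θ‖ ≤ 1)
    (η₁ η₂ R : ℝ) : Integrable (fun u => ‖cellWaveInt φ η₁ η₂ R u‖ ^ 2) unitSquare := by
  refine Integrable.of_bound (C := (2 * π) ^ 2)
    ((measurable_cellWaveInt hc η₁ η₂ R).norm.pow 2).aestronglyMeasurable
    (Filter.Eventually.of_forall fun u => ?_)
  rw [norm_pow, norm_norm]
  exact pow_le_pow_left₀ (norm_nonneg _) (norm_cellWaveInt_le hφ η₁ η₂ R u) 2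

lemma norm_integral_sq_le {α : Type*} [MeasurableSpace α] {μ : Measure α}
    [IsProbabilityMeasure μ] {F : α → ℂ} (hF : Integrable F μ)
    (hF2 : Integrable (fun x => ‖F x‖ ^ 2) μ) : ‖∫ x, F x ∂μ‖ ^ 2 ≤ ∫ x, ‖F x‖ ^ 2 ∂μ := by
  set m := ‖∫ x, F x ∂μ‖
  have h1 : m ≤ ∫ x, ‖F x‖ ∂μ := norm_integral_le_integral_norm F
  have h2 : ∫ x, (2 * m * ‖F x‖ - m ^ 2) ∂μ ≤ ∫ x, ‖F x‖ ^ 2 ∂μ :=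
    integral_mono ((hF.norm.const_mul _).sub (integrable_const _)) hF2 fun x => by
      nlinarith [sq_nonneg (‖F x‖ - m)]
  rw [integral_sub (hF.norm.const_mul _) (integrable_const _), integral_const_mul,
    integral_const] at h2
  simp at h2
  nlinarith [norm_nonneg (∫ x, F x ∂μ)]

lemma integral_cellWaveInt_mul {φ : ℝ → ℂ} (hc : Continuous φ) (hφ : ∀ θ, ‖φ θ‖ ≤ 1)
    (η₁ η₂ R : ℝ) :
    ∫ u, cellWaveInt φ η₁ η₂ R u *
        Complex.exp ((η₁ * (u.1 - 1 / 2) + η₂ * (u.2 - 1 / 2) : ℝ) * Complex.I) ∂unitSquare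
      = cellFactor η₁ * cellFactor η₂ * ∫ θ in (0 : ℝ)..2 * π, φ θ *
        Complex.exp ((-(η₁ * (R * cos θ) + η₂ * (R * sin θ)) : ℝ) * Complex.I) := by
  have hswap := integral_integral_swap (μ := unitSquare)
    (ν := volume.restrict (Set.Ioc 0 (2 * π)))
    (f := fun u θ => φ θ * Complex.exp
      ((-(η₁ * ⌊u.1 + R * cos θ⌋ + η₂ * ⌊u.2 + R * sin θ⌋) : ℝ) * Complex.I) *
        Complex.exp ((η₁ * (u.1 - 1 / 2) + η₂ * (u.2 - 1 / 2) : ℝ) * Complex.I)) (by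
      refine Integrable.of_bound (C := 1) (Measurable.aestronglyMeasurable
        ((measurable_cellWave hc η₁ η₂ R).mul (by fun_prop)))
        (Filter.Eventually.of_forall fun p => ?_)
      simp only [Function.uncurry]
      rw [norm_mul, norm_mul, Complex.norm_exp_ofReal_mul_I, Complex.norm_exp_ofReal_mul_I,
        mul_one, mul_one]
      exact hφ _)
  unfold cellWaveInt
  simp_rw [intervalIntegral.integral_of_le two_pi_pos.le, ← integral_mul_const]
  rw [hswap, ← integral_const_mul]
  refine integral_congr_ae (Filter.Eventually.of_forall fun θ => ?_)
  have hsplit : ∀ u : ℝ × ℝ, φ θ * Complex.exp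
      ((-(η₁ * ⌊u.1 + R * cos θ⌋ + η₂ * ⌊u.2 + R * sin θ⌋) : ℝ) * Complex.I) *
        Complex.exp ((η₁ * (u.1 - 1 / 2) + η₂ * (u.2 - 1 / 2) : ℝ) * Complex.I)
      = φ θ * (Complex.exp ((η₁ * (u.1 - 1 / 2 - ⌊u.1 + R * cos θ⌋) : ℝ) * Complex.I)
        * Complex.exp ((η₂ * (u.2 - 1 / 2 - ⌊u.2 + R * sin θ⌋) : ℝ) * Complex.I)) := by
    intro u
    rw [mul_assoc, ← Complex.exp_add, ← Complex.exp_add]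
    congr 2
    push_cast
    ring
  simp_rw [hsplit]
  rw [integral_const_mul, unitSquare, integral_prod_mul (L := ℂ)
    (fun x : ℝ => Complex.exp ((η₁ * (x - 1 / 2 - ⌊x + R * cos θ⌋) : ℝ) * Complex.I))
    (fun x : ℝ => Complex.exp ((η₂ * (x - 1 / 2 - ⌊x + R * sin θ⌋) : ℝ) * Complex.I)),
    ← intervalIntegral.integral_of_le zero_le_one, ← intervalIntegral.integral_of_le zero_le_one,
    integral_exp_sub_floor, integral_exp_sub_floor]
  have : Complex.exp ((-(η₁ * (R * cos θ) + η₂ * (R * sin θ)) : ℝ) * Complex.I)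
      = Complex.exp ((-(η₁ * (R * cos θ)) : ℝ) * Complex.I)
        * Complex.exp ((-(η₂ * (R * sin θ)) : ℝ) * Complex.I) := by
    rw [← Complex.exp_add]
    congr 1
    push_cast
    ring
  rw [this]
  ring

lemma le_integral_norm_sq_cellWaveInt {φ : ℝ → ℂ} (hc : Continuous φ) (hφ : ∀ θ, ‖φ θ‖ ≤ 1)
    {η₁ η₂ : ℝ} (h₁ : |η₁| ≤ π) (h₂ : |η₂| ≤ π) (R : ℝ) :
    1 / 16 * ‖∫ θ in (0 : ℝ)..2 * π, φ θ *
        Complex.exp ((-(η₁ * (R * cos θ) + η₂ * (R * sin θ)) : ℝ) * Complex.I)‖ ^ 2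
      ≤ ∫ u, ‖cellWaveInt φ η₁ η₂ R u‖ ^ 2 ∂unitSquare := by
  have hn : ∀ u, ‖cellWaveInt φ η₁ η₂ R u *
        Complex.exp ((η₁ * (u.1 - 1 / 2) + η₂ * (u.2 - 1 / 2) : ℝ) * Complex.I)‖
      = ‖cellWaveInt φ η₁ η₂ R u‖ := fun u => by
    rw [norm_mul, Complex.norm_exp_ofReal_mul_I, mul_one]
  have h := norm_integral_sq_le (μ := unitSquare) (F := fun u => cellWaveInt φ η₁ η₂ R u *
      Complex.exp ((η₁ * (u.1 - 1 / 2) + η₂ * (u.2 - 1 / 2) : ℝ) * Complex.I))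
    (Integrable.of_bound (C := 2 * π) ((measurable_cellWaveInt hc η₁ η₂ R).aestronglyMeasurable.mul
      (Continuous.aestronglyMeasurable (by fun_prop)))
      (Filter.Eventually.of_forall fun u => by
        rw [hn]; exact norm_cellWaveInt_le hφ η₁ η₂ R u))
    (by simp_rw [hn]; exact integrable_norm_sq_cellWaveInt hc hφ η₁ η₂ R)
  simp_rw [hn] at h
  rw [integral_cellWaveInt_mul hc hφ, norm_mul, norm_mul] at h
  refine le_trans ?_ h
  rw [mul_pow]
  have hk := mul_le_mul (half_le_norm_cellFactor h₁) (half_le_norm_cellFactor h₂) (by norm_num)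
    (norm_nonneg _)
  gcongr
  nlinarith

lemma one_div_le_integral_norm_sq_cellWaveInt {R η₁ η₂ : ℝ} (hR : 1 ≤ R) (h₁ : |η₁| ≤ π)
    (h₂ : |η₂| ≤ π) :
    1 / (16 * R) ≤ ∫ u, (‖cellWaveInt (fun _ => 1) η₁ η₂ R u‖ ^ 2
      + ‖cellWaveInt (fun θ => Complex.exp (θ * Complex.I)) η₁ η₂ R u‖ ^ 2) ∂unitSquare := by
  have hc : Continuous fun θ : ℝ => Complex.exp (θ * Complex.I) := by fun_prop
  have hb : ∀ θ : ℝ, ‖Complex.exp (θ * Complex.I)‖ ≤ 1 := fun θ =>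
    (Complex.norm_exp_ofReal_mul_I θ).le
  rw [integral_add (integrable_norm_sq_cellWaveInt continuous_const (by simp) _ _ _)
    (integrable_norm_sq_cellWaveInt hc hb _ _ _)]
  have e1 := le_integral_norm_sq_cellWaveInt (φ := fun _ => 1) continuous_const (by simp) h₁ h₂ R
  have e2 := le_integral_norm_sq_cellWaveInt hc hb h₁ h₂ R
  have e3 := one_div_le_norm_sq_add_norm_sq hR h₁ h₂
  simp only [one_mul] at e1
  calc 1 / (16 * R) = 1 / 16 * (1 / R) := by field_simp
    _ ≤ _ := by nlinarith

/-- The integral, over the circle with center `u` in the cell `k` and radius `R`, with weight `φ`,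
of the coloring `h` of the discrete torus. -/
noncomputable def torusCircleInt {M : ℕ} (φ : ℝ → ℂ) (h : ZMod M × ZMod M → ℂ) (R : ℝ)
    (u : ℝ × ℝ) (k : ZMod M × ZMod M) : ℂ :=
  ∫ θ in (0 : ℝ)..2 * π,
    φ θ * h (k + ((⌊u.1 + R * cos θ⌋ : ZMod M), (⌊u.2 + R * sin θ⌋ : ZMod M)))

lemma measurable_comp_floor_pair {α E : Type*} [MeasurableSpace α] [MeasurableSpace E]
    (H : ℤ → ℤ → E) {a b : α → ℝ} (ha : Measurable a) (hb : Measurable b) :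
    Measurable fun x => H ⌊a x⌋ ⌊b x⌋ :=
  (Measurable.of_discrete (f := fun p : ℤ × ℤ => H p.1 p.2)).comp (ha.floor.prodMk hb.floor)

lemma intervalIntegrable_torus {M : ℕ} {φ : ℝ → ℂ} (hc : Continuous φ) (hφ : ∀ θ, ‖φ θ‖ ≤ 1)
    {h : ZMod M × ZMod M → ℂ} (hh : ∀ z, ‖h z‖ ≤ 1) (R : ℝ) (u : ℝ × ℝ) (k : ZMod M × ZMod M) :
    IntervalIntegrable (fun θ => φ θ *
      h (k + ((⌊u.1 + R * cos θ⌋ : ZMod M), (⌊u.2 + R * sin θ⌋ : ZMod M)))) volume 0 (2 * π) := by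
  rw [intervalIntegrable_iff_integrableOn_Ioc_of_le two_pi_pos.le]
  refine Integrable.of_bound (C := 1) (Measurable.aestronglyMeasurable (hc.measurable.mul
    (measurable_comp_floor_pair (fun m n => h (k + ((m : ZMod M), (n : ZMod M))))
      (by fun_prop) (by fun_prop)))) (Filter.Eventually.of_forall fun θ => ?_)
  rw [norm_mul]
  exact mul_le_one₀ (hφ _) (norm_nonneg _) (hh _)

lemma norm_torusCircleInt_le {M : ℕ} {φ : ℝ → ℂ} (hφ : ∀ θ, ‖φ θ‖ ≤ 1)
    {h : ZMod M × ZMod M → ℂ} (hh : ∀ z, ‖h z‖ ≤ 1) (R : ℝ) (u : ℝ × ℝ) (k : ZMod M × ZMod M) :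
    ‖torusCircleInt φ h R u k‖ ≤ 2 * π := by
  have := intervalIntegral.norm_integral_le_of_norm_le_const (a := 0) (b := 2 * π) (C := 1)
    (f := fun θ => φ θ * h (k + ((⌊u.1 + R * cos θ⌋ : ZMod M), (⌊u.2 + R * sin θ⌋ : ZMod M))))
    (fun θ _ => by rw [norm_mul]; exact mul_le_one₀ (hφ _) (norm_nonneg _) (hh _))
  rwa [sub_zero, abs_of_pos two_pi_pos, one_mul] at this

lemma sum_torusCircleInt_mul {M : ℕ} [NeZero M] {φ : ℝ → ℂ} (hc : Continuous φ)
    (hφ : ∀ θ, ‖φ θ‖ ≤ 1) {h : ZMod M × ZMod M → ℂ} (hh : ∀ z, ‖h z‖ ≤ 1) (R : ℝ) (u : ℝ × ℝ)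
    (ψ : AddChar (ZMod M × ZMod M) ℂ) {η₁ η₂ : ℝ}
    (hψ : ∀ a b : ℤ, ψ ((a : ZMod M), (b : ZMod M))
      = Complex.exp ((η₁ * a + η₂ * b : ℝ) * Complex.I)) :
    ∑ k, torusCircleInt φ h R u k * ψ k = (∑ z, h z * ψ z) * cellWaveInt φ η₁ η₂ R u := by
  unfold torusCircleInt cellWaveInt
  simp_rw [← intervalIntegral.integral_mul_const]
  rw [← intervalIntegral.integral_finsetSum
    (fun k _ => (intervalIntegrable_torus hc hφ hh R u k).mul_const _),
    ← intervalIntegral.integral_const_mul]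
  refine intervalIntegral.integral_congr fun θ _ => ?_
  set j : ZMod M × ZMod M := ((⌊u.1 + R * cos θ⌋ : ZMod M), (⌊u.2 + R * sin θ⌋ : ZMod M)) with hj
  have hneg : ψ (-j) = Complex.exp
      ((-(η₁ * ⌊u.1 + R * cos θ⌋ + η₂ * ⌊u.2 + R * sin θ⌋) : ℝ) * Complex.I) := by
    have := hψ (-⌊u.1 + R * cos θ⌋) (-⌊u.2 + R * sin θ⌋)
    rw [hj, Prod.neg_mk, ← Int.cast_neg, ← Int.cast_neg, this]
    congr 2
    push_cast
    ring
  rw [← hneg, Finset.sum_mul,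
    ← Equiv.sum_comp (Equiv.addRight j) (fun z => h z * ψ z * (φ θ * ψ (-j)))]
  refine Finset.sum_congr rfl fun k _ => ?_
  simp only [Equiv.coe_addRight]
  rw [AddChar.map_add_eq_mul]
  have h1 : ψ j * ψ (-j) = 1 := by rw [← AddChar.map_add_eq_mul, add_neg_cancel,
    AddChar.map_zero_eq_one]
  linear_combination (-(φ θ * h (k + j) * ψ k)) * h1

lemma ZMod.card_near_boundary_le (M r : ℕ) [NeZero M] :
    (Finset.univ.filter fun a : ZMod M => a.val < r ∨ M ≤ a.val + r).card ≤ 2 * r := by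
  calc _ ≤ (Finset.range r ∪ Finset.Ico (M - r) M).card := by
        refine Finset.card_le_card_of_injOn ZMod.val (fun a ha => ?_)
          ((ZMod.val_injective M).injOn)
        have := ZMod.val_lt a
        simp at ha ⊢
        omega
    _ ≤ r + (M - (M - r)) := by
        refine (Finset.card_union_le _ _).trans ?_
        simp
    _ ≤ 2 * r := by omega

lemma sq_div_le_of_sum_torusCircleInt_le {M : ℕ} [NeZero M] {h : ZMod M × ZMod M → ℂ}
    (hh : ∀ z, ‖h z‖ = 1) {R B : ℝ} (hR : 1 ≤ R)
    (hB : ∀ u ∈ Set.Ioc (0 : ℝ) 1 ×ˢ Set.Ioc (0 : ℝ) 1,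
      ∑ k, (‖torusCircleInt (fun _ => 1) h R u k‖ ^ 2
        + ‖torusCircleInt (fun θ => Complex.exp (θ * Complex.I)) h R u k‖ ^ 2) ≤ B) :
    (M : ℝ) ^ 2 / (16 * R) ≤ B := by
  have hh' : ∀ z, ‖h z‖ ≤ 1 := fun z => (hh z).le
  have hc : Continuous fun θ : ℝ => Complex.exp (θ * Complex.I) := by fun_prop
  have hb : ∀ θ : ℝ, ‖Complex.exp (θ * Complex.I)‖ ≤ 1 := fun θ =>
    (Complex.norm_exp_ofReal_mul_I θ).le
  have hcard : (Fintype.card (ZMod M × ZMod M) : ℝ) = (M : ℝ) ^ 2 := by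
    rw [Fintype.card_prod, ZMod.card]; push_cast; ring
  have hM : (0 : ℝ) < M := by exact_mod_cast Nat.pos_of_ne_zero (NeZero.ne M)
  choose η₁ η₂ h₁ h₂ hψ using fun ψ : AddChar (ZMod M × ZMod M) ℂ => ψ.exists_angles
  set H : AddChar (ZMod M × ZMod M) ℂ → ℝ := fun ψ => ‖∑ z, h z * ψ z‖ ^ 2 with hH
  set A : AddChar (ZMod M × ZMod M) ℂ → ℝ × ℝ → ℝ := fun ψ u =>
    ‖cellWaveInt (fun _ => 1) (η₁ ψ) (η₂ ψ) R u‖ ^ 2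
      + ‖cellWaveInt (fun θ => Complex.exp (θ * Complex.I)) (η₁ ψ) (η₂ ψ) R u‖ ^ 2 with hA
  have hAint : ∀ ψ, Integrable (A ψ) unitSquare := fun ψ =>
    (integrable_norm_sq_cellWaveInt continuous_const (by simp) _ _ _).add
      (integrable_norm_sq_cellWaveInt hc hb _ _ _)
  have hsumH : ∑ ψ, H ψ = (M : ℝ) ^ 2 * (M : ℝ) ^ 2 := by
    rw [AddChar.sum_norm_sq_sum_mul, hcard]
    simp only [hh, one_pow, Finset.sum_const, Finset.card_univ, nsmul_eq_mul, hcard, mul_one]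
  have hpt : ∀ u ∈ Set.Ioc (0 : ℝ) 1 ×ˢ Set.Ioc (0 : ℝ) 1,
      ∑ ψ, H ψ * A ψ u ≤ (M : ℝ) ^ 2 * B := by
    intro u hu
    have p1 := AddChar.sum_norm_sq_sum_mul (torusCircleInt (fun _ => 1) h R u)
    have p2 := AddChar.sum_norm_sq_sum_mul
      (torusCircleInt (fun θ => Complex.exp (θ * Complex.I)) h R u)
    simp_rw [fun ψ => sum_torusCircleInt_mul (φ := fun _ => 1) continuous_const (by simp) hh' R u
      ψ (hψ ψ), norm_mul, mul_pow] at p1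
    simp_rw [fun ψ => sum_torusCircleInt_mul hc hb hh' R u ψ (hψ ψ), norm_mul, mul_pow] at p2
    calc ∑ ψ, H ψ * A ψ u = (M : ℝ) ^ 2 * ∑ k, (‖torusCircleInt (fun _ => 1) h R u k‖ ^ 2
          + ‖torusCircleInt (fun θ => Complex.exp (θ * Complex.I)) h R u k‖ ^ 2) := by
          simp only [hA, hH, mul_add, Finset.sum_add_distrib]
          rw [p1, p2, hcard]
      _ ≤ _ := by gcongr; exact hB u hu
  have hae : ∀ᵐ u ∂unitSquare, ∑ ψ, H ψ * A ψ u ≤ (M : ℝ) ^ 2 * B := by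
    rw [unitSquare, Measure.prod_restrict,
      ae_restrict_iff' (measurableSet_Ioc.prod measurableSet_Ioc)]
    exact Filter.Eventually.of_forall hpt
  have hfin := integral_mono_ae (integrable_finsetSum _ fun ψ _ => (hAint ψ).const_mul (H ψ))
    (integrable_const _) hae
  rw [integral_finsetSum _ fun ψ _ => (hAint ψ).const_mul (H ψ), integral_const] at hfin
  simp_rw [integral_const_mul] at hfin
  simp only [probReal_univ, one_smul] at hfin
  have hlow : ∑ ψ, H ψ * (1 / (16 * R)) ≤ ∑ ψ, H ψ * ∫ u, A ψ u ∂unitSquare :=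
    Finset.sum_le_sum fun ψ _ => mul_le_mul_of_nonneg_left
      (one_div_le_integral_norm_sq_cellWaveInt hR (h₁ ψ) (h₂ ψ)) (by positivity)
  rw [← Finset.sum_mul, hsumH] at hlow
  have := hlow.trans hfin
  rw [mul_assoc] at this
  have := le_of_mul_le_mul_left this (by positivity)
  rwa [mul_one_div] at this

lemma sum_near_boundary_le (M r : ℕ) [NeZero M] (c d : ℝ) (hd : 0 ≤ d)
    {v : ZMod M × ZMod M → ℝ} (hv : ∀ k, v k ≤ c + d)
    (hv' : ∀ k : ZMod M × ZMod M, r ≤ k.1.val → k.1.val + r < M → r ≤ k.2.val →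
      k.2.val + r < M → v k ≤ c) :
    ∑ k, v k ≤ c * M ^ 2 + 4 * d * r * M := by
  set b : ZMod M → ℝ := fun a => if a.val < r ∨ M ≤ a.val + r then d else 0 with hb
  have hb0 : ∀ a, 0 ≤ b a := fun a => by simp only [hb]; split_ifs <;> simp [hd]
  have hbs : ∑ a, b a ≤ 2 * r * d := by
    simp only [hb]
    rw [← Finset.sum_filter, Finset.sum_const, nsmul_eq_mul]
    gcongr
    exact_mod_cast ZMod.card_near_boundary_le M r
  have hle : ∀ k : ZMod M × ZMod M, v k ≤ c + (b k.1 + b k.2) := by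
    intro k
    by_cases h1 : k.1.val < r ∨ M ≤ k.1.val + r
    · have : b k.1 = d := if_pos h1
      linarith [hv k, hb0 k.2]
    by_cases h2 : k.2.val < r ∨ M ≤ k.2.val + r
    · have : b k.2 = d := if_pos h2
      linarith [hv k, hb0 k.1]
    have := hv' k (by omega) (by omega) (by omega) (by omega)
    linarith [hb0 k.1, hb0 k.2]
  refine (Finset.sum_le_sum fun k _ => hle k).trans ?_
  rw [Finset.sum_add_distrib, Fintype.sum_prod_type, Fintype.sum_prod_type]
  simp only [Finset.sum_add_distrib, Finset.sum_const, Finset.card_univ, ZMod.card, nsmul_eq_mul]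
  rw [← Finset.mul_sum]
  have hM : (0 : ℝ) ≤ M := Nat.cast_nonneg M
  nlinarith

lemma ZMod.val_add_intCast_of_interior {M r : ℕ} [NeZero M] {a : ZMod M} {j : ℤ}
    (ha : r ≤ a.val) (ha' : a.val + r < M) (hj : -(r : ℤ) ≤ j) (hj' : j ≤ r) :
    ((a + (j : ZMod M)).val : ℤ) = a.val + j := by
  obtain ⟨n, hn⟩ := Int.eq_ofNat_of_zero_le (a := a.val + j) (by omega)
  have h : a + (j : ZMod M) = (n : ZMod M) := by
    rw [← Int.cast_natCast n, ← hn]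
    simp
  rw [h, ZMod.val_cast_of_lt (by omega), hn]

lemma floor_add_mul_mem {r : ℕ} {R u t : ℝ} (hr : R + 1 ≤ r) (hR : 0 ≤ R) (hu : 0 < u)
    (hu' : u ≤ 1) (ht : |t| ≤ 1) : -(r : ℤ) ≤ ⌊u + R * t⌋ ∧ ⌊u + R * t⌋ ≤ r := by
  obtain ⟨h1, h2⟩ := abs_le.1 ht
  constructor
  · rw [Int.le_floor]
    push_cast
    nlinarith
  · have := Int.floor_le (u + R * t)
    have h3 : (⌊u + R * t⌋ : ℝ) ≤ (r : ℝ) := by nlinarith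
    exact_mod_cast h3

lemma sq_div_le_of_abs_integral_le {g : ℤ → ℤ → ℝ} (hg : ∀ m n, |g m n| = 1) {R D : ℝ}
    (hR : 1 ≤ R) (hD : ∀ a b : ℝ, ∀ s ∈ Set.Icc 0 (2 * π),
      |∫ θ in (0 : ℝ)..s, g ⌊a + R * cos θ⌋ ⌊b + R * sin θ⌋| ≤ D)
    (M r : ℕ) [NeZero M] (hr : R + 1 ≤ r) :
    (M : ℝ) ^ 2 / (16 * R) ≤ 257 * D ^ 2 * M ^ 2 + 320 * r * M := by
  set h : ZMod M × ZMod M → ℂ := fun z => (g z.1.val z.2.val : ℂ) with hh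
  have hnorm : ∀ z, ‖h z‖ = 1 := fun z => by
    simp only [hh, Complex.norm_real, Real.norm_eq_abs, hg]
  have hb : ∀ θ : ℝ, ‖Complex.exp (θ * Complex.I)‖ ≤ 1 := fun θ =>
    (Complex.norm_exp_ofReal_mul_I θ).le
  refine sq_div_le_of_sum_torusCircleInt_le hnorm hR fun u hu => ?_
  obtain ⟨⟨hu1, hu1'⟩, hu2, hu2'⟩ := hu
  have key := sum_near_boundary_le M r (257 * D ^ 2) 80 (by norm_num)
    (v := fun k => ‖torusCircleInt (fun _ => 1) h R u k‖ ^ 2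
        + ‖torusCircleInt (fun θ => Complex.exp (θ * Complex.I)) h R u k‖ ^ 2) ?_ ?_
  · linarith
  · intro k
    have h1 := norm_torusCircleInt_le (φ := fun _ => 1) (by simp) (fun z => (hnorm z).le) R u k
    have h2 := norm_torusCircleInt_le hb (fun z => (hnorm z).le) R u k
    have h3 := pow_le_pow_left₀ (norm_nonneg _) h1 2
    have h4 := pow_le_pow_left₀ (norm_nonneg _) h2 2
    have h5 : π ^ 2 ≤ 10 := by nlinarith [Real.pi_lt_d2, Real.pi_pos]
    nlinarith [sq_nonneg D]
  · intro k k1 k1' k2 k2'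
    set F : ℝ → ℝ := fun θ => g ⌊(k.1.val + u.1) + R * cos θ⌋ ⌊(k.2.val + u.2) + R * sin θ⌋
      with hF
    have hval : ∀ θ : ℝ, h (k + ((⌊u.1 + R * cos θ⌋ : ZMod M), (⌊u.2 + R * sin θ⌋ : ZMod M)))
        = F θ := by
      intro θ
      obtain ⟨a1, a2⟩ := floor_add_mul_mem hr (by linarith) hu1 hu1' (abs_cos_le_one θ)
      obtain ⟨b1, b2⟩ := floor_add_mul_mem hr (by linarith) hu2 hu2' (abs_sin_le_one θ)
      simp only [hh, hF, Prod.fst_add, Prod.snd_add]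
      rw [ZMod.val_add_intCast_of_interior k1 k1' a1 a2,
        ZMod.val_add_intCast_of_interior k2 k2' b1 b2, add_assoc, add_assoc,
        Int.floor_natCast_add, Int.floor_natCast_add]
    have hFi : IntervalIntegrable F volume 0 (2 * π) := by
      rw [intervalIntegrable_iff_integrableOn_Ioc_of_le two_pi_pos.le]
      exact Integrable.of_bound (C := 1) (Measurable.aestronglyMeasurable
        (measurable_comp_floor_pair g (by fun_prop) (by fun_prop)))
        (Filter.Eventually.of_forall fun θ => (hg _ _).le)
    have h1 : ‖torusCircleInt (fun _ => 1) h R u k‖ ≤ D := by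
      simp only [torusCircleInt, hval, one_mul]
      rw [intervalIntegral.integral_ofReal, Complex.norm_real]
      exact hD _ _ _ ⟨two_pi_pos.le, le_rfl⟩
    have h2 : ‖torusCircleInt (fun θ => Complex.exp (θ * Complex.I)) h R u k‖ ≤ 16 * D := by
      simp only [torusCircleInt, hval]
      exact norm_integral_exp_mul_le hFi fun s hs => hD _ _ s hs
    have h3 := pow_le_pow_left₀ (norm_nonneg _) h1 2
    have h4 := pow_le_pow_left₀ (norm_nonneg _) h2 2
    linarith

lemma exists_abs_integral_gt {g : ℤ → ℤ → ℝ} (hg : ∀ m n, |g m n| = 1) {R D : ℝ} (hR : 1 ≤ R)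
    (hD : D ^ 2 * R ≤ 1 / 10000) : ∃ a b : ℝ, ∃ s ∈ Set.Icc 0 (2 * π),
      D < |∫ θ in (0 : ℝ)..s, g ⌊a + R * cos θ⌋ ⌊b + R * sin θ⌋| := by
  by_contra! H
  obtain ⟨r, hr⟩ := exists_nat_ge (R + 1)
  have hr0 : (0 : ℝ) < r := by linarith
  obtain ⟨M, hM⟩ := exists_nat_ge (10000 * R * r)
  have hM0 : (0 : ℝ) < M := lt_of_lt_of_le (by positivity) hM
  have : NeZero M := ⟨by rintro rfl; simp at hM0⟩
  have key := sq_div_le_of_abs_integral_le hg hR H M r hr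
  rw [div_le_iff₀ (by positivity)] at key
  have h1 : (M : ℝ) ≤ 16 * 257 * (D ^ 2 * R) * M + 5120 * R * r := by
    refine le_of_mul_le_mul_right ?_ hM0
    linarith
  have h2 : 16 * 257 * (D ^ 2 * R) * M ≤ 16 * 257 * (1 / 10000) * M := by gcongr
  nlinarith [mul_pos (zero_lt_one.trans_le hR) hr0]

/-- For any coloring of the infinite checkerboard there are circular arcs of arbitrarily
large radius `R` whose discrepancy is at least `C √R`, `C > 0` an absolute constant. -/
theorem arcs_large_discrepancy :
    ∃ C > (0:ℝ), ∀ f : Pt → ℝ,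
      (∀ x, f x = 1 ∨ f x = -1) →
      (∀ m n : ℤ, ∀ x : Pt, x 0 ∈ Set.Ico (m:ℝ) (m+1) → x 1 ∈ Set.Ico (n:ℝ) (n+1) →
        f x = f (pt m n)) →
      ∀ R₀ : ℝ, ∃ R ≥ R₀, ∃ (x : Pt) (θ₁ θ₂ : ℝ), θ₁ < θ₂ ∧ θ₂ ≤ θ₁ + 2 * π ∧
        C * Real.sqrt R ≤ |arcInt f x R θ₁ θ₂| := by
  refine ⟨1 / 100, by norm_num, fun f hf hcell R₀ => ⟨max R₀ 1, le_max_left _ _, ?_⟩⟩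
  set R := max R₀ 1
  have hR : 1 ≤ R := le_max_right _ _
  have hR0 : 0 < R := by linarith
  set g : ℤ → ℤ → ℝ := fun m n => f (pt m n) with hg
  have hg1 : ∀ m n, |g m n| = 1 := fun m n => by
    rcases hf (pt m n) with h | h <;> simp [hg, h]
  have hsq : (1 / 100 * √R / R) ^ 2 * R ≤ 1 / 10000 := by
    rw [div_pow, mul_pow, Real.sq_sqrt hR0.le]
    field_simp
    norm_num
  obtain ⟨a, b, s, hs, hlt⟩ := exists_abs_integral_gt hg1 hR hsq
  have hfg : ∀ θ, f (pt a b + R • dir θ) = g ⌊a + R * cos θ⌋ ⌊b + R * sin θ⌋ := fun θ => by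
    refine hcell _ _ _ ?_ ?_
    · simp [pt, dir, Int.floor_le]
    · simp [pt, dir, Int.floor_le]
  refine ⟨pt a b, 0, s, hs.1.lt_of_ne ?_, by simpa using hs.2, ?_⟩
  · rintro rfl
    rw [intervalIntegral.integral_same, abs_zero] at hlt
    exact hlt.not_ge (by positivity)
  · simp only [arcInt, hfg]
    rw [intervalIntegral.integral_mul_const, abs_mul, abs_of_pos hR0]
    exact ((div_lt_iff₀ hR0).1 hlt).le
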